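/- Let ε > 0, let f : ℝ → ℝ be Lipschitz continuous with constant L ≥ 0. Then |∫_ℝ δ_ε(y) f(y) dy - f(0)| ≤ L · ε · (1/2 - 2/π²); in particular, the weighted average ∫_ℝ δ_ε(y) f(y) dy converges to f(0) as ε → 0⁺. -/

import Mathlib

open MeasureTheory Topology Filter

/-- The smoothed Dirac delta used by the RIIS method:
`δ_ε(y) = (1/(2ε))(1 + cos(πy/ε))` if `|y| ≤ ε`, and `0` otherwise. -/
noncomputable def smoothedDelta (ε y : ℝ) : ℝ :=
  if |y| ≤ ε then (1 / (2 * ε)) * (1 + Real.cos (Real.pi * y / ε)) else 0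

lemma sd_integral (ε : ℝ) (hε : 0 < ε) (g : ℝ → ℝ) :
    (∫ y : ℝ, smoothedDelta ε y * g y) =
      ∫ y in (-ε)..ε, (1 / (2 * ε)) * (1 + Real.cos (Real.pi * y / ε)) * g y := by
  rw [intervalIntegral.integral_of_le (by linarith), ← integral_Icc_eq_integral_Ioc,
    ← integral_indicator measurableSet_Icc]
  congr 1
  ext y
  by_cases h : |y| ≤ ε
  · rw [Set.indicator_of_mem (by exact abs_le.mp h)]
    simp [smoothedDelta, h]
  · rw [Set.indicator_of_notMem (fun h' : y ∈ Set.Icc (-ε) ε => h (abs_le.mpr h'))]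
    simp [smoothedDelta, h]

lemma sd_mass (ε : ℝ) (hε : 0 < ε) :
    (∫ y in (-ε)..ε, (1 / (2 * ε)) * (1 + Real.cos (Real.pi * y / ε))) = 1 := by
  have hpi := Real.pi_pos
  rw [intervalIntegral.integral_eq_sub_of_hasDerivAt
    (f := fun y => (1 / (2 * ε)) * (y + (ε / Real.pi) * Real.sin (Real.pi * y / ε)))]
  · have h1 : Real.pi * ε / ε = Real.pi := by field_simp
    have h2 : Real.pi * -ε / ε = -Real.pi := by field_simp
    simp only [h1, h2, Real.sin_neg, Real.sin_pi]
    field_simp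
    ring
  · intro y _
    have h := ((hasDerivAt_id y).const_mul Real.pi).div_const ε
    have := ((hasDerivAt_id y).add (h.sin.const_mul (ε / Real.pi))).const_mul (1 / (2 * ε))
    refine HasDerivAt.congr_deriv this ?_
    simp only [id]
    field_simp
  · apply Continuous.intervalIntegrable
    fun_prop

lemma sd_anti (ε : ℝ) (hε : 0 < ε) (y : ℝ) :
    HasDerivAt (fun y => (1 / (2 * ε)) * (y * y / 2 + ((ε / Real.pi) * (y * Real.sin (Real.pi * y / ε))
      + (ε / Real.pi) ^ 2 * Real.cos (Real.pi * y / ε))))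
      ((1 / (2 * ε)) * (1 + Real.cos (Real.pi * y / ε)) * y) y := by
  have hpi := Real.pi_pos
  have h := ((hasDerivAt_id y).const_mul Real.pi).div_const ε
  have := ((((hasDerivAt_id y).mul (hasDerivAt_id y)).div_const 2).add
    ((((hasDerivAt_id y).mul h.sin).const_mul (ε / Real.pi)).add
      (h.cos.const_mul ((ε / Real.pi) ^ 2)))).const_mul (1 / (2 * ε))
  refine HasDerivAt.congr_deriv this ?_
  simp only [id]
  field_simp
  ring

lemma sd_moment (ε : ℝ) (hε : 0 < ε) :
    (∫ y in (-ε)..ε, (1 / (2 * ε)) * (1 + Real.cos (Real.pi * y / ε)) * |y|) =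
      ε * (1 / 2 - 2 / Real.pi ^ 2) := by
  have hpi := Real.pi_pos
  have h1 : Real.pi * ε / ε = Real.pi := by field_simp
  have h2 : Real.pi * -ε / ε = -Real.pi := by field_simp
  have hi : ∀ a b : ℝ, IntervalIntegrable
      (fun y => (1 / (2 * ε)) * (1 + Real.cos (Real.pi * y / ε)) * |y|) volume a b := by
    intro a b
    apply Continuous.intervalIntegrable
    fun_prop
  rw [← intervalIntegral.integral_add_adjacent_intervals (hi (-ε) 0) (hi 0 ε)]
  have e1 : (∫ y in (-ε)..0, (1 / (2 * ε)) * (1 + Real.cos (Real.pi * y / ε)) * |y|) =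
      ∫ y in (-ε)..0, -((1 / (2 * ε)) * (1 + Real.cos (Real.pi * y / ε)) * y) := by
    apply intervalIntegral.integral_congr
    intro y hy
    rw [Set.uIcc_of_le (by linarith)] at hy
    simp only [abs_of_nonpos hy.2]
    ring
  have e2 : (∫ y in (0:ℝ)..ε, (1 / (2 * ε)) * (1 + Real.cos (Real.pi * y / ε)) * |y|) =
      ∫ y in (0:ℝ)..ε, ((1 / (2 * ε)) * (1 + Real.cos (Real.pi * y / ε)) * y) := by
    apply intervalIntegral.integral_congr
    intro y hy
    rw [Set.uIcc_of_le (by linarith)] at hy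
    simp only [abs_of_nonneg hy.1]
  rw [e1, e2, intervalIntegral.integral_neg,
    intervalIntegral.integral_eq_sub_of_hasDerivAt (fun y _ => sd_anti ε hε y)
      (Continuous.intervalIntegrable (by fun_prop) _ _),
    intervalIntegral.integral_eq_sub_of_hasDerivAt (fun y _ => sd_anti ε hε y)
      (Continuous.intervalIntegrable (by fun_prop) _ _)]
  simp only [h1, h2, Real.sin_neg, Real.sin_pi, Real.cos_neg, Real.cos_pi, mul_zero, zero_div,
    Real.cos_zero, Real.sin_zero]
  field_simp
  ring

lemma sd_bound (f : ℝ → ℝ) (L : ℝ) (hL : 0 ≤ L)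
    (hf : ∀ x y : ℝ, |f x - f y| ≤ L * |x - y|) (ε : ℝ) (hε : 0 < ε) :
    |(∫ y : ℝ, smoothedDelta ε y * f y) - f 0| ≤ L * ε * (1 / 2 - 2 / Real.pi ^ 2) := by
  have hc : Continuous f := by
    have : LipschitzWith ⟨L, hL⟩ f := LipschitzWith.of_dist_le_mul (fun x y => by
      rw [Real.dist_eq, Real.dist_eq]; exact hf x y)
    exact this.continuous
  rw [sd_integral ε hε]
  have e : (∫ y in (-ε)..ε, (1 / (2 * ε)) * (1 + Real.cos (Real.pi * y / ε)) * f y) - f 0 =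
      ∫ y in (-ε)..ε, (1 / (2 * ε)) * (1 + Real.cos (Real.pi * y / ε)) * (f y - f 0) := by
    simp only [mul_sub]
    rw [intervalIntegral.integral_sub (Continuous.intervalIntegrable (by fun_prop) _ _)
      (Continuous.intervalIntegrable (by fun_prop) _ _), intervalIntegral.integral_mul_const,
      sd_mass ε hε, one_mul]
  rw [e, mul_assoc, ← sd_moment ε hε, ← intervalIntegral.integral_const_mul]
  refine (intervalIntegral.abs_integral_le_integral_abs (by linarith)).trans ?_
  apply intervalIntegral.integral_mono_on (by linarith)
    (Continuous.intervalIntegrable (by fun_prop) _ _)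
    (Continuous.intervalIntegrable (by fun_prop) _ _)
  intro y _
  have hk : 0 ≤ (1 / (2 * ε)) * (1 + Real.cos (Real.pi * y / ε)) :=
    mul_nonneg (by positivity) (by linarith [Real.neg_one_le_cos (Real.pi * y / ε)])
  rw [abs_mul, abs_of_nonneg hk]
  have := mul_le_mul_of_nonneg_left (hf y 0) hk
  rw [sub_zero] at this
  linarith

/-- Let `f : ℝ → ℝ` be Lipschitz continuous with constant `L ≥ 0`. Then for every
`ε > 0`, `|∫_ℝ δ_ε(y) f(y) dy - f(0)| ≤ L · ε · (1/2 - 2/π²)`; in particular,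
the weighted average `∫_ℝ δ_ε(y) f(y) dy` converges to `f(0)` as `ε → 0⁺`. -/
theorem smoothedDelta_average_lipschitz (f : ℝ → ℝ) (L : ℝ) (hL : 0 ≤ L)
    (hf : ∀ x y : ℝ, |f x - f y| ≤ L * |x - y|) :
    (∀ ε : ℝ, 0 < ε →
        |(∫ y : ℝ, smoothedDelta ε y * f y) - f 0| ≤
          L * ε * (1 / 2 - 2 / Real.pi ^ 2)) ∧
      Tendsto (fun ε : ℝ => ∫ y : ℝ, smoothedDelta ε y * f y)
        (𝓝[>] (0 : ℝ)) (𝓝 (f 0)) := by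
  refine ⟨sd_bound f L hL hf, ?_⟩
  rw [tendsto_iff_dist_tendsto_zero]
  have hlim : Tendsto (fun ε : ℝ => L * ε * (1 / 2 - 2 / Real.pi ^ 2)) (𝓝[>] (0 : ℝ)) (𝓝 0) := by
    have : Continuous (fun ε : ℝ => L * ε * (1 / 2 - 2 / Real.pi ^ 2)) := by fun_prop
    have h := this.tendsto 0
    simp only [mul_zero, zero_mul] at h
    exact h.mono_left nhdsWithin_le_nhds
  refine squeeze_zero' (Eventually.of_forall fun _ => dist_nonneg) ?_ hlim
  filter_upwards [self_mem_nhdsWithin] with ε hε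
  rw [Real.dist_eq]
  exact sd_bound f L hL hf ε hε
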